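/- Let p be an odd prime, let s ∈ ℤ_p with s ≠ 1, let a ∈ ℚ_p with |a|_p > 1, and let r ∈ ℕ. Then the following identity holds in ℚ_p, the infinite series being convergent: −(1/(s−1))·⟨a⟩^{1−s} = (2/(s−1))·Σ_{k=1}^{p^r−1} (−1)^k ⟨k+a⟩^{1−s} + (1/ω_v(a))·Σ_{k=1}^{p^r−1} (−1)^k ⟨k+a⟩^{−s} + Σ_{n=2}^∞ [ (∏_{j=1}^{n−1}(s−1+j)) / (n!·ω_v(a)^n) ]·Σ_{k=1}^{p^r−1} (−1)^k ⟨k+a⟩^{1−s−n} − (1/(s−1))·⟨p^r − 1 + a⟩^{1−s}. -/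

import Mathlib

open Filter Topology

noncomputable def teich (p : ℕ) [Fact p.Prime] (u : ℚ_[p]) : ℚ_[p] :=
  limUnder atTop fun n : ℕ => u ^ p ^ n

noncomputable def omegaV (p : ℕ) [Fact p.Prime] (a : ℚ_[p]) : ℚ_[p] :=
  (p : ℚ_[p]) ^ a.valuation * teich p (a * (p : ℚ_[p]) ^ (-a.valuation))

noncomputable def proj (p : ℕ) [Fact p.Prime] (a : ℚ_[p]) : ℚ_[p] :=
  a / omegaV p a

noncomputable def binom (p : ℕ) [Fact p.Prime] (s : ℚ_[p]) (n : ℕ) : ℚ_[p] :=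
  (∏ j ∈ Finset.range n, (s - (j : ℚ_[p]))) / (n.factorial : ℚ_[p])

noncomputable def hpow (p : ℕ) [Fact p.Prime] (a s : ℚ_[p]) : ℚ_[p] :=
  ∑' n : ℕ, binom p s n * (proj p a - 1) ^ n

noncomputable def zetaE (p : ℕ) [Fact p.Prime] (s a : ℚ_[p]) : ℚ_[p] :=
  limUnder atTop fun r : ℕ =>
    ∑ k ∈ Finset.range (p ^ r), (-1 : ℚ_[p]) ^ k * hpow p ((k : ℚ_[p]) + a) (1 - s)

noncomputable def coeffT (p : ℕ) [Fact p.Prime] (s a : ℚ_[p]) (n : ℕ) : ℚ_[p] :=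
  (∏ j ∈ Finset.Icc 1 (n - 1), (s - 1 + (j : ℚ_[p]))) /
    ((n.factorial : ℚ_[p]) * omegaV p a ^ n)

theorem norm_pow_prime_pow_sub_le (p : ℕ) [Fact p.Prime] {x y : ℤ_[p]} (h : ‖x - y‖ < 1) (n : ℕ) :
    ‖x ^ p ^ n - y ^ p ^ n‖ ≤ (p : ℝ) ^ (-((n + 1 : ℕ) : ℤ)) := by
  rw [PadicInt.norm_le_pow_iff_mem_span_pow, Ideal.mem_span_singleton]
  exact dvd_sub_pow_of_dvd_sub (PadicInt.norm_lt_one_iff_dvd _ |>.1 h) n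

theorem norm_pow_prime_sub_self_lt_one (p : ℕ) [Fact p.Prime] (x : ℤ_[p]) : ‖x ^ p - x‖ < 1 := by
  rw [← PadicInt.mem_nonunits, ← IsLocalRing.mem_maximalIdeal, ← PadicInt.ker_toZMod,
    RingHom.mem_ker]
  simp [ZMod.pow_card]

theorem tendsto_zpow_neg_succ (p : ℕ) [Fact p.Prime] :
    Tendsto (fun n : ℕ => (p : ℝ) ^ (-((n + 1 : ℕ) : ℤ))) atTop (𝓝 0) := by
  have hp : (1 : ℝ) < p := by exact_mod_cast (Fact.out : p.Prime).one_lt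
  have h := (tendsto_pow_atTop_nhds_zero_of_lt_one (inv_nonneg.2 (by positivity))
    (inv_lt_one_of_one_lt₀ hp)).comp (tendsto_add_atTop_nat 1)
  refine h.congr fun n => ?_
  rw [zpow_neg, zpow_natCast, Function.comp_apply, inv_pow]

theorem norm_pow_prime_pow_sub_self_lt_one (p : ℕ) [Fact p.Prime] (x : ℤ_[p]) (n : ℕ) :
    ‖x ^ p ^ n - x‖ < 1 := by
  induction n with
  | zero => simp
  | succ n ih =>
    have h := norm_pow_prime_sub_self_lt_one p (x ^ p ^ n)
    rw [← pow_mul, ← pow_succ] at h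
    have := PadicInt.nonarchimedean (x ^ p ^ (n + 1) - x ^ p ^ n) (x ^ p ^ n - x)
    rw [sub_add_sub_cancel] at this
    exact this.trans_lt (max_lt h ih)

theorem exists_tendsto_pow_prime_pow (p : ℕ) [Fact p.Prime] (x : ℤ_[p]) :
    ∃ L : ℤ_[p], Tendsto (fun n : ℕ => x ^ p ^ n) atTop (𝓝 L) ∧ ‖L - x‖ < 1 := by
  have hp : (1 : ℝ) < p := by exact_mod_cast (Fact.out : p.Prime).one_lt
  have hc : CauchySeq (fun n : ℕ => x ^ p ^ n) := by
    refine cauchySeq_of_le_geometric ((p : ℝ)⁻¹) 1 (inv_lt_one_of_one_lt₀ hp) fun n => ?_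
    rw [dist_comm, dist_eq_norm, pow_succ', pow_mul, one_mul]
    refine (norm_pow_prime_pow_sub_le p (norm_pow_prime_sub_self_lt_one p x) n).trans ?_
    rw [inv_pow, ← zpow_natCast, ← zpow_neg]
    exact zpow_le_zpow_right₀ hp.le (by push_cast; omega)
  obtain ⟨L, hL⟩ := cauchySeq_tendsto_of_complete hc
  refine ⟨L, hL, ?_⟩
  obtain ⟨n, hn⟩ := ((tendsto_iff_norm_sub_tendsto_zero.1 hL).eventually_lt_const one_pos).exists
  have := PadicInt.nonarchimedean (L - x ^ p ^ n) (x ^ p ^ n - x)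
  rw [sub_add_sub_cancel, norm_sub_rev L (x ^ p ^ n)] at this
  exact this.trans_lt (max_lt hn (norm_pow_prime_pow_sub_self_lt_one p x n))

theorem tendsto_teich (p : ℕ) [Fact p.Prime] {u : ℚ_[p]} (hu : ‖u‖ ≤ 1) :
    Tendsto (fun n : ℕ => u ^ p ^ n) atTop (𝓝 (teich p u)) ∧ ‖teich p u - u‖ < 1 := by
  obtain ⟨u, rfl⟩ : ∃ w : ℤ_[p], (w : ℚ_[p]) = u := ⟨⟨u, hu⟩, rfl⟩
  obtain ⟨L, hL, hLu⟩ := exists_tendsto_pow_prime_pow p u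
  have h : Tendsto (fun n : ℕ => (u : ℚ_[p]) ^ p ^ n) atTop (𝓝 (L : ℚ_[p])) :=
    ((continuous_subtype_val.tendsto L).comp hL).congr fun n => PadicInt.coe_pow u (p ^ n)
  have ht : teich p u = L := h.limUnder_eq
  rw [ht]
  exact ⟨h, by exact_mod_cast hLu⟩

theorem teich_congr (p : ℕ) [Fact p.Prime] {u v : ℚ_[p]} (hu : ‖u‖ ≤ 1) (hv : ‖v‖ ≤ 1)
    (huv : ‖u - v‖ < 1) : teich p u = teich p v := by
  have h := (tendsto_teich p hu).1.sub (tendsto_teich p hv).1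
  obtain ⟨u, rfl⟩ : ∃ w : ℤ_[p], (w : ℚ_[p]) = u := ⟨⟨u, hu⟩, rfl⟩
  obtain ⟨v, rfl⟩ : ∃ w : ℤ_[p], (w : ℚ_[p]) = v := ⟨⟨v, hv⟩, rfl⟩
  refine sub_eq_zero.1 (tendsto_nhds_unique h ?_)
  refine squeeze_zero_norm (fun n => ?_) (tendsto_zpow_neg_succ p)
  exact_mod_cast norm_pow_prime_pow_sub_le p (by exact_mod_cast huv : ‖u - v‖ < 1) n

theorem norm_mul_zpow_neg_valuation (p : ℕ) [Fact p.Prime] {a : ℚ_[p]} (ha : a ≠ 0) :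
    ‖a * (p : ℚ_[p]) ^ (-a.valuation)‖ = 1 := by
  have hp : (p : ℝ) ≠ 0 := by exact_mod_cast (Fact.out : p.Prime).ne_zero
  rw [norm_mul, Padic.norm_p_zpow, Padic.norm_eq_zpow_neg_valuation ha, ← zpow_add₀ hp]
  simp

theorem norm_teich (p : ℕ) [Fact p.Prime] {u : ℚ_[p]} (hu : ‖u‖ = 1) : ‖teich p u‖ = 1 := by
  have h := (tendsto_teich p hu.le).2
  rw [sub_eq_add_neg] at h
  have := IsUltrametricDist.norm_eq_of_add_norm_lt_max
    (h.trans_le (le_max_of_le_right (by rw [norm_neg, hu])))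
  rwa [norm_neg, hu] at this

theorem omegaV_ne_zero (p : ℕ) [Fact p.Prime] {a : ℚ_[p]} (ha : a ≠ 0) : omegaV p a ≠ 0 := by
  have hp : (p : ℚ_[p]) ≠ 0 := by exact_mod_cast (Fact.out : p.Prime).ne_zero
  refine mul_ne_zero (zpow_ne_zero _ hp) (norm_ne_zero_iff.1 ?_)
  rw [norm_teich p (norm_mul_zpow_neg_valuation p ha)]
  exact one_ne_zero

theorem norm_proj_sub_one_lt_one (p : ℕ) [Fact p.Prime] {a : ℚ_[p]} (ha : a ≠ 0) :
    ‖proj p a - 1‖ < 1 := by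
  have hp : (p : ℚ_[p]) ≠ 0 := by exact_mod_cast (Fact.out : p.Prime).ne_zero
  have hu := norm_mul_zpow_neg_valuation p ha
  have ht := norm_teich p hu
  have ht0 : teich p (a * (p : ℚ_[p]) ^ (-a.valuation)) ≠ 0 :=
    norm_ne_zero_iff.1 (ht ▸ one_ne_zero)
  have h : proj p a - 1 = (a * (p : ℚ_[p]) ^ (-a.valuation) -
      teich p (a * (p : ℚ_[p]) ^ (-a.valuation))) /
      teich p (a * (p : ℚ_[p]) ^ (-a.valuation)) := by
    rw [sub_div, div_self ht0, proj, omegaV, zpow_neg, mul_comm _ (teich p _), ← div_div,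
      div_right_comm, div_eq_mul_inv a]
  rw [h, norm_div, ht, div_one, norm_sub_rev]
  exact (tendsto_teich p hu.le).2

theorem norm_add_eq_of_norm_le_one (p : ℕ) [Fact p.Prime] {a x : ℚ_[p]} (ha : 1 < ‖a‖)
    (hx : ‖x‖ ≤ 1) : ‖x + a‖ = ‖a‖ := by
  have h := hx.trans_lt ha
  rw [IsUltrametricDist.norm_add_eq_max_of_norm_ne_norm h.ne, max_eq_right h.le]

theorem omegaV_add_of_norm_le_one (p : ℕ) [Fact p.Prime] {a x : ℚ_[p]} (ha : 1 < ‖a‖)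
    (hx : ‖x‖ ≤ 1) : omegaV p (x + a) = omegaV p a := by
  have hp : (1 : ℝ) < p := by exact_mod_cast (Fact.out : p.Prime).one_lt
  have ha0 : a ≠ 0 := norm_pos_iff.1 (zero_lt_one.trans ha)
  have hn := norm_add_eq_of_norm_le_one p ha hx
  have hb0 : x + a ≠ 0 := norm_pos_iff.1 (hn ▸ zero_lt_one.trans ha)
  have hv : (x + a).valuation = a.valuation := by
    rw [Padic.norm_eq_zpow_neg_valuation ha0, Padic.norm_eq_zpow_neg_valuation hb0] at hn
    exact neg_injective (zpow_right_injective₀ (by positivity) hp.ne' hn)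
  have hu := norm_mul_zpow_neg_valuation p ha0
  have hu' := norm_mul_zpow_neg_valuation p hb0
  rw [omegaV, omegaV, teich_congr p hu'.le hu.le, hv]
  rw [hv, ← sub_mul, add_sub_cancel_right]
  calc ‖x * (p : ℚ_[p]) ^ (-a.valuation)‖ < ‖a * (p : ℚ_[p]) ^ (-a.valuation)‖ := by
        rw [norm_mul, norm_mul] at *
        exact mul_lt_mul_of_pos_right (hx.trans_lt ha)
          (lt_of_le_of_ne (norm_nonneg _) fun h => by rw [← h, mul_zero] at hu; exact zero_ne_one hu)
    _ = 1 := hu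

theorem binom_eq_choose (p : ℕ) [Fact p.Prime] (t : ℤ_[p]) (n : ℕ) :
    binom p t n = ((Ring.choose t n : ℤ_[p]) : ℚ_[p]) := by
  have h : ∀ m : ℕ, ((descPochhammer ℤ m).smeval t : ℤ_[p]) =
      ∏ j ∈ Finset.range m, (t - (j : ℤ_[p])) := fun m => by
    rw [← Polynomial.aeval_eq_smeval]
    induction m with
    | zero => simp
    | succ m ih => simp [descPochhammer_succ_right, ih, Finset.prod_range_succ]
  have hn : (n.factorial : ℚ_[p]) ≠ 0 := by exact_mod_cast n.factorial_ne_zero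
  have h1 := Ring.descPochhammer_eq_factorial_smul_choose t n
  rw [h, nsmul_eq_mul] at h1
  have h2 := congrArg (PadicInt.Coe.ringHom (p := p)) h1
  rw [map_prod, map_mul, map_natCast] at h2
  rw [binom, div_eq_iff hn, mul_comm]
  refine Eq.trans (Finset.prod_congr rfl fun j _ => ?_) h2
  rw [map_sub, map_natCast]
  rfl

instance isBoundedSMul_padicInt_padic (p : ℕ) [Fact p.Prime] : IsBoundedSMul ℤ_[p] ℚ_[p] :=
  IsBoundedSMul.of_norm_smul_le fun x y => by
    rw [Algebra.smul_def, norm_mul]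
    rfl

theorem hasSum_addChar (p : ℕ) [Fact p.Prime] {r : ℚ_[p]} (hr : Tendsto (r ^ ·) atTop (𝓝 0))
    (t : ℤ_[p]) :
    HasSum (fun n : ℕ => binom p t n * r ^ n) (PadicInt.addChar_of_value_at_one r hr t) := by
  have h := ContinuousMap.hasSum_apply (PadicInt.hasSum_mahlerSeries hr) t
  rw [PadicInt.coe_addChar_of_value_at_one]
  refine h.congr_fun fun n => ?_
  rw [PadicInt.mahlerTerm_apply, mahler_apply, binom_eq_choose, Algebra.smul_def]
  rfl

theorem hpow_eq_addChar (p : ℕ) [Fact p.Prime] (a : ℚ_[p])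
    (hr : Tendsto ((proj p a - 1) ^ ·) atTop (𝓝 0)) (t : ℤ_[p]) :
    hpow p a t = PadicInt.addChar_of_value_at_one (proj p a - 1) hr t :=
  (hasSum_addChar p hr t).tsum_eq

/-- `(xy)^t = x^t y^t` for `p`-adic powers of principal units. -/
theorem addChar_mul_of_value (p : ℕ) [Fact p.Prime] {r r' r'' : ℚ_[p]}
    (hr : Tendsto (r ^ ·) atTop (𝓝 0)) (hr' : Tendsto (r' ^ ·) atTop (𝓝 0))
    (hr'' : Tendsto (r'' ^ ·) atTop (𝓝 0)) (h : 1 + r'' = (1 + r) * (1 + r')) (t : ℤ_[p]) :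
    PadicInt.addChar_of_value_at_one r'' hr'' t =
      PadicInt.addChar_of_value_at_one r hr t * PadicInt.addChar_of_value_at_one r' hr' t := by
  have hc : Continuous (PadicInt.addChar_of_value_at_one r hr *
      PadicInt.addChar_of_value_at_one r' hr' : AddChar ℤ_[p] ℚ_[p]) :=
    (PadicInt.continuous_addChar_of_value_at_one hr).mul
      (PadicInt.continuous_addChar_of_value_at_one hr')
  rw [← PadicInt.eq_addChar_of_value_at_one hr'' hc (by simp [h]), AddChar.mul_apply]

theorem hpow_sub_natCast_mul_pow (p : ℕ) [Fact p.Prime] {a : ℚ_[p]} (ha : a ≠ 0) (t : ℤ_[p])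
    (n : ℕ) : hpow p a (t - n) * proj p a ^ n = hpow p a t := by
  have hr := tendsto_pow_atTop_nhds_zero_of_norm_lt_one (norm_proj_sub_one_lt_one p ha)
  have h1 : ((t : ℚ_[p]) - n) = ((t - n : ℤ_[p]) : ℚ_[p]) := by simp
  have h2 := AddChar.map_nsmul_eq_pow (PadicInt.addChar_of_value_at_one (proj p a - 1) hr) n
    (1 : ℤ_[p])
  rw [PadicInt.addChar_of_value_at_one_def, add_sub_cancel, nsmul_one] at h2
  rw [h1, hpow_eq_addChar p a hr, hpow_eq_addChar p a hr, ← h2, ← AddChar.map_add_eq_mul,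
    sub_add_cancel]

/-- The binomial expansion of `⟨b - 1⟩^t` about `⟨b⟩`. -/
theorem hasSum_hpow_sub_one (p : ℕ) [Fact p.Prime] {b : ℚ_[p]} (hb : 1 < ‖b‖) (t : ℤ_[p]) :
    HasSum (fun n : ℕ => binom p t n * (-1 / omegaV p b) ^ n * hpow p b (t - n))
      (hpow p (b - 1) t) := by
  have hb0 : b ≠ 0 := norm_pos_iff.1 (zero_lt_one.trans hb)
  have hm : ‖(-1 : ℚ_[p])‖ ≤ 1 := by simp
  have hn := norm_add_eq_of_norm_le_one p hb hm
  have hw := omegaV_add_of_norm_le_one p hb hm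
  rw [neg_add_eq_sub] at hn hw
  have hc0 : b - 1 ≠ 0 := norm_pos_iff.1 (hn ▸ zero_lt_one.trans hb)
  have hw0 := omegaV_ne_zero p hb0
  have hr := tendsto_pow_atTop_nhds_zero_of_norm_lt_one (norm_proj_sub_one_lt_one p hb0)
  have hr'' := tendsto_pow_atTop_nhds_zero_of_norm_lt_one (norm_proj_sub_one_lt_one p hc0)
  have hr' : Tendsto ((-1 / b) ^ ·) atTop (𝓝 0) :=
    tendsto_pow_atTop_nhds_zero_of_norm_lt_one (by
      rw [norm_div, norm_neg, norm_one]
      exact (div_lt_one (zero_lt_one.trans hb)).2 hb)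
  have hmul := addChar_mul_of_value p hr hr' hr'' (by
    rw [proj, proj, hw]
    field_simp
    ring) t
  rw [hpow_eq_addChar p _ hr'', hmul, ← hpow_eq_addChar]
  refine ((hasSum_addChar p hr' t).mul_left (hpow p b t)).congr_fun fun n => ?_
  rw [← hpow_sub_natCast_mul_pow p hb0 t n]
  have hx : -1 / omegaV p b = proj p b * (-1 / b) := by
    rw [proj]
    field_simp
  rw [hx, mul_pow]
  ring

theorem sub_one_mul_coeffT (p : ℕ) [Fact p.Prime] (s a : ℚ_[p]) (n : ℕ) :
    (s - 1) * coeffT p s a (n + 2) = binom p (1 - s) (n + 2) * (-1 / omegaV p a) ^ (n + 2) := by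
  have h1 : ∏ j ∈ Finset.range (n + 2), (1 - s - (j : ℚ_[p])) =
      (-1) ^ (n + 2) * ((s - 1) * ∏ j ∈ Finset.Icc 1 (n + 1), (s - 1 + (j : ℚ_[p]))) := by
    have h2 : ∏ j ∈ Finset.range (n + 2), (1 - s - (j : ℚ_[p])) =
        ∏ j ∈ Finset.range (n + 2), (-1) * (s - 1 + (j : ℚ_[p])) :=
      Finset.prod_congr rfl fun j _ => by ring
    rw [h2, Finset.prod_mul_distrib, Finset.prod_const, Finset.card_range,
      Finset.prod_range_eq_mul_Ico _ (by omega)]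
    rw [Nat.cast_zero, add_zero, ← Finset.Ico_add_one_right_eq_Icc]
    rfl
  have h3 : ((-1 : ℚ_[p]) ^ (n + 2)) * (-1) ^ (n + 2) = 1 := by
    rw [← mul_pow]
    simp
  rw [coeffT, binom, h1, div_pow, show n + 2 - 1 = n + 1 from rfl, div_mul_div_comm,
    mul_right_comm, h3, one_mul, mul_div_assoc]

/-- The tail, from the quadratic term on, of the binomial expansion of `⟨b - 1⟩^{1-s}`. -/
theorem hasSum_coeffT_mul_hpow (p : ℕ) [Fact p.Prime] {s : ℚ_[p]} (hs : ‖s‖ ≤ 1) (hs1 : s ≠ 1)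
    {b : ℚ_[p]} (hb : 1 < ‖b‖) :
    HasSum (fun n : ℕ => coeffT p s b (n + 2) * hpow p b (1 - s - ((n : ℚ_[p]) + 2)))
      (1 / (s - 1) * (hpow p (b - 1) (1 - s) - hpow p b (1 - s)) -
        1 / omegaV p b * hpow p b (-s)) := by
  have hs0 : s - 1 ≠ 0 := sub_ne_zero.2 hs1
  obtain ⟨t, rfl⟩ : ∃ t : ℤ_[p], (t : ℚ_[p]) = s := ⟨⟨s, hs⟩, rfl⟩
  have h := hasSum_hpow_sub_one p hb (1 - t)
  rw [PadicInt.coe_sub, PadicInt.coe_one, ← hasSum_nat_add_iff' 2] at h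
  have h0 : binom p (1 - (t : ℚ_[p])) 0 = 1 := by simp [binom]
  have h1 : binom p (1 - (t : ℚ_[p])) 1 = 1 - t := by simp [binom]
  rw [Finset.sum_range_succ, Finset.sum_range_one, h0, h1, Nat.cast_zero, Nat.cast_one, sub_zero,
    show 1 - (t : ℚ_[p]) - 1 = -t by ring] at h
  have hval : 1 / ((t : ℚ_[p]) - 1) * (hpow p (b - 1) (1 - t) - hpow p b (1 - t)) -
      1 / omegaV p b * hpow p b (-t) = 1 / ((t : ℚ_[p]) - 1) * (hpow p (b - 1) (1 - t) -
        (1 * (-1 / omegaV p b) ^ 0 * hpow p b (1 - t) +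
          (1 - t) * (-1 / omegaV p b) ^ 1 * hpow p b (-t))) := by
    field_simp
    ring
  rw [hval]
  refine (h.mul_left (1 / ((t : ℚ_[p]) - 1))).congr_fun fun n => ?_
  rw [← sub_one_mul_coeffT]
  push_cast
  field_simp

theorem sum_Ico_neg_one_pow_mul_pred {R : Type*} [CommRing R] (f : ℕ → R) {N : ℕ} (hN : Odd N) :
    ∑ k ∈ Finset.Ico 1 N, (-1) ^ k * f (k - 1) =
      f (N - 1) - f 0 - ∑ k ∈ Finset.Ico 1 N, (-1) ^ k * f k := by
  obtain ⟨m, rfl⟩ := hN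
  rw [Finset.sum_Ico_eq_sum_range, Finset.sum_Ico_eq_sum_range]
  induction m with
  | zero => simp
  | succ m ih =>
    simp only [Nat.add_sub_cancel_left, Nat.add_sub_cancel] at ih ⊢
    rw [show 2 * (m + 1) = 2 * m + 1 + 1 by ring, Finset.sum_range_succ, Finset.sum_range_succ, ih,
      Finset.sum_range_succ, Finset.sum_range_succ]
    simp only [pow_add, pow_mul, show 1 + (2 * m + 1) = 2 * m + 1 + 1 by ring,
      show 1 + 2 * m = 2 * m + 1 by ring]
    ring

/-- identity (4+) of the paper: for an odd prime `p`, `s ∈ ℤ_p` with `s ≠ 1`,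
`a ∈ ℚ_p` with `|a|_p > 1`, and `r ∈ ℕ`:
`-(1/(s-1)) ⟨a⟩^{1-s}
  = (2/(s-1)) ∑_{k=1}^{p^r-1} (-1)^k ⟨k+a⟩^{1-s}
  + (1/ω_v(a)) ∑_{k=1}^{p^r-1} (-1)^k ⟨k+a⟩^{-s}
  + ∑_{n≥2} [∏_{j=1}^{n-1}(s-1+j)]/(n! ω_v(a)^n) ∑_{k=1}^{p^r-1} (-1)^k ⟨k+a⟩^{1-s-n}
  - (1/(s-1)) ⟨p^r - 1 + a⟩^{1-s}`, the infinite series being convergent. -/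
theorem padic_hurwitz_euler_partial_sum_identity
    (p : ℕ) [Fact p.Prime] (hodd : p ≠ 2)
    (s : ℚ_[p]) (hs : ‖s‖ ≤ 1) (hs1 : s ≠ 1)
    (a : ℚ_[p]) (ha : 1 < ‖a‖)
    (r : ℕ) :
    Summable (fun n : ℕ =>
      coeffT p s a (n + 2) *
        ∑ k ∈ Finset.Ico 1 (p ^ r),
          (-1 : ℚ_[p]) ^ k * hpow p ((k : ℚ_[p]) + a) (1 - s - ((n : ℚ_[p]) + 2))) ∧
    -(1 / (s - 1)) * hpow p a (1 - s) =
      2 / (s - 1) *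
          ∑ k ∈ Finset.Ico 1 (p ^ r), (-1 : ℚ_[p]) ^ k * hpow p ((k : ℚ_[p]) + a) (1 - s) +
        1 / omegaV p a *
          ∑ k ∈ Finset.Ico 1 (p ^ r), (-1 : ℚ_[p]) ^ k * hpow p ((k : ℚ_[p]) + a) (-s) +
        (∑' n : ℕ,
          coeffT p s a (n + 2) *
            ∑ k ∈ Finset.Ico 1 (p ^ r),
              (-1 : ℚ_[p]) ^ k * hpow p ((k : ℚ_[p]) + a) (1 - s - ((n : ℚ_[p]) + 2))) -
        1 / (s - 1) * hpow p (((p : ℚ_[p]) ^ r - 1 + a)) (1 - s) := by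
  have hs0 : s - 1 ≠ 0 := sub_ne_zero.2 hs1
  have hterm (k : ℕ) : HasSum
      (fun n : ℕ => coeffT p s a (n + 2) *
        ((-1 : ℚ_[p]) ^ k * hpow p ((k : ℚ_[p]) + a) (1 - s - ((n : ℚ_[p]) + 2))))
      ((-1 : ℚ_[p]) ^ k * (1 / (s - 1) * (hpow p ((k : ℚ_[p]) + a - 1) (1 - s) -
        hpow p ((k : ℚ_[p]) + a) (1 - s)) -
        1 / omegaV p a * hpow p ((k : ℚ_[p]) + a) (-s))) := by
    have hk : ‖(k : ℚ_[p])‖ ≤ 1 := by simpa using Padic.norm_int_le_one (p := p) k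
    have hw := omegaV_add_of_norm_le_one p ha hk
    have h := (hasSum_coeffT_mul_hpow p hs hs1
      ((norm_add_eq_of_norm_le_one p ha hk).symm ▸ ha)).mul_left ((-1 : ℚ_[p]) ^ k)
    rw [hw] at h
    refine h.congr_fun fun n => ?_
    rw [coeffT, coeffT, hw]
    ring
  have hsum := hasSum_sum (s := Finset.Ico 1 (p ^ r)) fun k _ => hterm k
  simp only [← Finset.mul_sum] at hsum
  refine ⟨hsum.summable, ?_⟩
  rw [hsum.tsum_eq]
  have hN : Odd (p ^ r) := ((Fact.out : p.Prime).odd_of_ne_two hodd).pow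
  have htel := sum_Ico_neg_one_pow_mul_pred
    (fun k : ℕ => hpow p ((k : ℚ_[p]) + a) (1 - s)) hN
  have hpred : ∑ k ∈ Finset.Ico 1 (p ^ r),
      (-1 : ℚ_[p]) ^ k * hpow p (((k - 1 : ℕ) : ℚ_[p]) + a) (1 - s) =
      ∑ k ∈ Finset.Ico 1 (p ^ r), (-1 : ℚ_[p]) ^ k * hpow p ((k : ℚ_[p]) + a - 1) (1 - s) :=
    Finset.sum_congr rfl fun k hk => by
      rw [Nat.cast_sub (Finset.mem_Ico.1 hk).1, Nat.cast_one, sub_add_eq_add_sub]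
  rw [hpred, Nat.cast_sub hN.pos, Nat.cast_pow, Nat.cast_one, Nat.cast_zero, zero_add] at htel
  simp only [mul_sub, Finset.sum_sub_distrib, mul_left_comm ((-1 : ℚ_[p]) ^ _),
    ← Finset.mul_sum]
  rw [htel]
  field_simp
  ring
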